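/- arXiv:math-ph/9911031 — 5 statements merged into one kernel-verified Lean document; each statement's English description precedes it below -/
import Mathlib

section
/- Let H : ℝ → ℝ be an even function with H ∈ L¹(ℝ) ∩ L²(ℝ), and suppose 1 + Ĥ(k) > 0 for every k ∈ ℝ. Then for every x > 0 and every h ∈ L²((0,x)) there exists a unique Γ ∈ L²((0,x)) such that Γ(t) + ∫₀ˣ H(t−u) Γ(u) du = h(t) for almost every t ∈ (0,x). (In particular, for each s ∈ [0,x], Krein's equation Γ(t) + ∫₀ˣ H(t−u) Γ(u) du = H(t−s) is uniquely solvable in L²((0,x)).) -/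
open MeasureTheory Set
open scoped FourierTransform ContDiff ENNReal

theorem fourier_toLp_ae_eq {f : ℝ → ℂ} (hf : Integrable f) (hf2 : MemLp f 2) :
    ((𝓕 (hf2.toLp f) : Lp ℂ 2 (volume : Measure ℝ)) : ℝ → ℂ) =ᵐ[volume] 𝓕 f := by
  have hcont : Continuous (𝓕 f) :=
    VectorFourier.fourierIntegral_continuous Real.continuous_fourierChar
      (by simpa using! continuous_inner) hf
  refine ae_eq_of_integral_contDiff_smul_eq
    ((Lp.memLp (𝓕 (hf2.toLp f))).locallyIntegrable (by norm_num)) hcont.locallyIntegrable ?_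
  intro g g_smooth g_cpt
  have hg₁ : HasCompactSupport (Complex.ofRealCLM ∘ g) := g_cpt.comp_left rfl
  have hg₂ : ContDiff ℝ ∞ (Complex.ofRealCLM ∘ g) := by fun_prop
  set G := hg₁.toSchwartzMap hg₂
  have hG (t : ℝ) : G t = (g t : ℂ) := rfl
  have key := congrArg (fun T => T G) (Lp.fourier_toTemperedDistribution_eq (hf2.toLp f))
  simp only [TemperedDistribution.fourier_apply, Lp.toTemperedDistribution_apply] at key
  have h1 : ∫ t, 𝓕 G t • (hf2.toLp f : ℝ → ℂ) t = ∫ t, 𝓕 G t • f t := by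
    apply integral_congr_ae
    filter_upwards [hf2.coeFn_toLp] with t ht
    rw [ht]
  have h2 : ∫ t, 𝓕 (G : ℝ → ℂ) t • f t = ∫ t, G t • 𝓕 f t := by
    simpa using! VectorFourier.integral_bilin_fourierIntegral_eq_flip (.lsmul ℂ ℂ) (L := innerₗ ℝ)
      Real.continuous_fourierChar continuous_inner G.integrable hf
  rw [h1] at key
  simp only [SchwartzMap.fourier_coe] at key
  rw [h2] at key
  simpa [hG] using key.symm

theorem exists_pos_le_one_add_integral_cos {H : ℝ → ℝ} (hL1 : Integrable H)
    (hpos : ∀ k : ℝ, 0 < 1 + ∫ t : ℝ, H t * Real.cos (k * t)) :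
    ∃ c > 0, ∀ k : ℝ, c ≤ 1 + ∫ t : ℝ, H t * Real.cos (k * t) := by
  have hre (k : ℝ) : ∫ t : ℝ, H t * Real.cos (k * t) =
      (𝓕 (fun t => (H t : ℂ)) (k / (2 * Real.pi))).re := by
    rw [Real.fourier_real_eq_integral_exp_smul]
    have hint : Integrable (fun t : ℝ =>
        Complex.exp (↑(-2 * Real.pi * t * (k / (2 * Real.pi))) * Complex.I) • (H t : ℂ)) := by
      refine hL1.ofReal.bdd_mul (c := 1) (by fun_prop) (.of_forall fun t => ?_)
      rw [Complex.norm_exp_ofReal_mul_I]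
    rw [← Complex.reCLM_apply, ← ContinuousLinearMap.integral_comp_comm _ hint]
    refine integral_congr_ae (.of_forall fun t => ?_)
    have harg : -2 * Real.pi * t * (k / (2 * Real.pi)) = -(k * t) := by
      field_simp
    simp only [Complex.reCLM_apply, smul_eq_mul, Complex.re_mul_ofReal,
      Complex.exp_ofReal_mul_I_re]
    rw [harg, Real.cos_neg, mul_comm]
  have hcont : Continuous (𝓕 (fun t => (H t : ℂ))) :=
    VectorFourier.fourierIntegral_continuous Real.continuous_fourierChar
      (by simpa using! continuous_inner) hL1.ofReal
  have hpos' (k : ℝ) : 0 < 1 + (𝓕 (fun t => (H t : ℂ)) k).re := by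
    have := hpos (2 * Real.pi * k)
    rwa [hre, mul_div_cancel_left₀ _ (by positivity)] at this
  have hlim : Filter.Tendsto (fun k => 1 + (𝓕 (fun t => (H t : ℂ)) k).re)
      (Filter.cocompact ℝ) (nhds 1) := by
    simpa using! ((Complex.continuous_re.tendsto _).comp
      (Real.zero_at_infty_fourier (fun t => (H t : ℂ)))).const_add 1
  obtain ⟨K, hK, hKc⟩ := Filter.mem_cocompact.1
    (hlim.eventually (lt_mem_nhds (show (1 / 2 : ℝ) < 1 by norm_num)))
  obtain ⟨a, ha, haK⟩ := hK.exists_forall_le' (f := fun k => 1 + (𝓕 (fun t => (H t : ℂ)) k).re)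
    (by fun_prop) (a := 0) (fun k _ => hpos' k)
  refine ⟨min a (1 / 2), by positivity, fun k => ?_⟩
  rw [hre]
  by_cases hk : k / (2 * Real.pi) ∈ K
  · exact (min_le_left _ _).trans (haK _ hk)
  · exact (min_le_right _ _).trans (le_of_lt (hKc hk))

theorem integrable_norm_fourier_sq {f : ℝ → ℂ} (hf : Integrable f) (hf2 : MemLp f 2) :
    Integrable (fun k => ‖𝓕 f k‖ ^ 2) :=
  ((memLp_congr_ae (fourier_toLp_ae_eq hf hf2)).1 (Lp.memLp _)).integrable_norm_pow two_ne_zero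

theorem integral_inner_fourier_fourier_eq {f g : ℝ → ℂ} (hf : Integrable f) (hf2 : MemLp f 2)
    (hg : Integrable g) (hg2 : MemLp g 2) :
    ∫ k, inner ℂ (𝓕 f k) (𝓕 g k) = ∫ t, inner ℂ (f t) (g t) := by
  have key := Lp.inner_fourier_eq (hf2.toLp f) (hg2.toLp g)
  rw [L2.inner_def, L2.inner_def] at key
  convert key using 1
  · apply integral_congr_ae
    filter_upwards [fourier_toLp_ae_eq hf hf2, fourier_toLp_ae_eq hg hg2] with k h1 h2
    rw [h1, h2]
  · apply integral_congr_ae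
    filter_upwards [hf2.coeFn_toLp, hg2.coeFn_toLp] with k h1 h2
    rw [h1, h2]

theorem integral_mul_translate_eq {v : ℝ → ℝ} (hv : Integrable v) (hv2 : MemLp v 2) (s : ℝ) :
    ∫ t, v t * v (t - s) =
      ∫ k, ‖𝓕 (fun t => (v t : ℂ)) k‖ ^ 2 * Real.cos (2 * Real.pi * k * s) := by
  set f : ℝ → ℂ := fun t => (v t : ℂ) with hf_def
  have hf : Integrable f := hv.ofReal
  have hf2 : MemLp f 2 := hv2.ofReal
  have hmp : MeasurePreserving (fun t : ℝ => t + -s) :=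
    measurePreserving_add_right volume (-s)
  have hg : Integrable (f ∘ fun t => t + -s) := hmp.integrable_comp_of_integrable hf
  have hg2 : MemLp (f ∘ fun t => t + -s) 2 := hf2.comp_measurePreserving hmp
  have key := integral_inner_fourier_fourier_eq hf hf2 hg hg2
  have htr : 𝓕 (f ∘ fun t => t + -s) = fun k => Real.fourierChar (-s * k) • 𝓕 f k := by
    simpa [mul_comm] using! VectorFourier.fourierIntegral_comp_add_right Real.fourierChar volume
      (innerₗ ℝ) f (-s)
  have hint : Integrable (fun k => inner ℂ (𝓕 f k) (𝓕 (f ∘ fun t => t + -s) k)) := by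
    have hL := L2.integrable_inner (𝕜 := ℂ) (𝓕 (hf2.toLp f)) (𝓕 (hg2.toLp _))
    refine hL.congr ?_
    filter_upwards [fourier_toLp_ae_eq hf hf2, fourier_toLp_ae_eq hg hg2] with k h1 h2
    rw [h1, h2]
  have h1 : ∫ t, inner ℂ (f t) ((f ∘ fun t => t + -s) t) = ((∫ t, v t * v (t - s) : ℝ) : ℂ) := by
    rw [← integral_complex_ofReal]
    refine integral_congr_ae (.of_forall fun t => ?_)
    simp [hf_def, sub_eq_add_neg, mul_comm]
  rw [h1] at key
  have key' := congrArg Complex.re key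
  rw [Complex.ofReal_re, ← Complex.reCLM_apply,
    ← ContinuousLinearMap.integral_comp_comm _ hint] at key'
  rw [← key']
  refine integral_congr_ae (.of_forall fun k => ?_)
  have hz : (starRingEnd ℂ) (𝓕 f k) * 𝓕 f k = ((‖𝓕 f k‖ ^ 2 : ℝ) : ℂ) := by
    rw [mul_comm, Complex.mul_conj, Complex.normSq_eq_norm_sq]
  have hinner : inner ℂ (𝓕 f k) (Real.fourierChar (-s * k) • 𝓕 f k) =
      ((‖𝓕 f k‖ ^ 2 : ℝ) : ℂ) * Complex.exp (((2 * Real.pi * (-s * k) : ℝ) : ℂ) * Complex.I) := by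
    rw [← hz, Circle.smul_def, inner_smul_right, Real.fourierChar_apply, RCLike.inner_apply]
    push_cast
    ring
  simp only [htr, Complex.reCLM_apply]
  rw [hinner, Complex.re_ofReal_mul, Complex.exp_ofReal_mul_I_re, ← Real.cos_neg]
  congr 2
  ring

theorem integral_mul_integral_sub_mul_eq {H v : ℝ → ℝ} (hL1 : Integrable H) (hv : Integrable v)
    (hv2 : MemLp v 2) :
    ∫ t, v t * ∫ u, H (t - u) * v u =
      ∫ k, ‖𝓕 (fun t => (v t : ℂ)) k‖ ^ 2 * ∫ s, H s * Real.cos (2 * Real.pi * k * s) := by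
  have hN : Integrable (fun k => ‖𝓕 (fun t => (v t : ℂ)) k‖ ^ 2) :=
    integrable_norm_fourier_sq hv.ofReal hv2.ofReal
  have hsq : Integrable (fun t => v t ^ 2) := hv2.integrable_sq
  have hint1 : Integrable (fun p : ℝ × ℝ => v p.1 * (H p.2 * v (p.1 - p.2)))
      (volume.prod volume) := by
    have hb1 : Integrable (fun p : ℝ × ℝ => v p.1 ^ 2 * ‖H p.2‖) (volume.prod volume) :=
      hsq.mul_prod hL1.norm
    have hb2 : Integrable (fun p : ℝ × ℝ => ‖H p.2‖ * v (p.1 - p.2) ^ 2) (volume.prod volume) :=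
      hL1.norm.convolution_integrand (ContinuousLinearMap.mul ℝ ℝ) hsq
    refine (hb1.add hb2).mono' ?_ (.of_forall fun p => ?_)
    · exact hv.aestronglyMeasurable.comp_fst.mul
        (hL1.aestronglyMeasurable.convolution_integrand (ContinuousLinearMap.mul ℝ ℝ)
          hv.aestronglyMeasurable)
    · simp only [Pi.add_apply, norm_mul, Real.norm_eq_abs]
      have h0 := abs_nonneg (H p.2)
      rw [← sq_abs (v p.1), ← sq_abs (v (p.1 - p.2))]
      nlinarith [mul_nonneg h0 (sq_nonneg (|v p.1| - |v (p.1 - p.2)|)),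
        mul_nonneg h0 (sq_nonneg (|v p.1|)), mul_nonneg h0 (sq_nonneg (|v (p.1 - p.2)|))]
  have hint2 : Integrable (fun p : ℝ × ℝ => H p.1 * (‖𝓕 (fun t => (v t : ℂ)) p.2‖ ^ 2 *
      Real.cos (2 * Real.pi * p.2 * p.1))) (volume.prod volume) := by
    have := (hL1.mul_prod hN).mul_bdd (c := 1)
      (g := fun p : ℝ × ℝ => Real.cos (2 * Real.pi * p.2 * p.1))
      (by fun_prop) (.of_forall fun p => by simpa using Real.abs_cos_le_one _)
    simpa only [mul_assoc] using this
  calc ∫ t, v t * ∫ u, H (t - u) * v u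
      = ∫ t, ∫ s, v t * (H s * v (t - s)) := by
        refine integral_congr_ae (.of_forall fun t => ?_)
        simp only
        rw [integral_const_mul, ← integral_sub_left_eq_self (fun s => H s * v (t - s)) volume t]
        simp
    _ = ∫ s, ∫ t, v t * (H s * v (t - s)) := integral_integral_swap hint1
    _ = ∫ s, ∫ k, H s * (‖𝓕 (fun t => (v t : ℂ)) k‖ ^ 2 *
          Real.cos (2 * Real.pi * k * s)) := by
        refine integral_congr_ae (.of_forall fun s => ?_)
        simp only
        rw [integral_const_mul, ← integral_mul_translate_eq hv hv2, ← integral_const_mul]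
        simp only [mul_left_comm]
    _ = ∫ k, ∫ s, H s * (‖𝓕 (fun t => (v t : ℂ)) k‖ ^ 2 *
          Real.cos (2 * Real.pi * k * s)) := integral_integral_swap hint2
    _ = _ := by
        refine integral_congr_ae (.of_forall fun k => ?_)
        simp only
        rw [← integral_const_mul]
        simp only [mul_left_comm]

theorem le_quadratic_form {H v : ℝ → ℝ} (hL1 : Integrable H) (hv : Integrable v)
    (hv2 : MemLp v 2) {c : ℝ} (hc : ∀ k : ℝ, c ≤ 1 + ∫ t : ℝ, H t * Real.cos (k * t)) :
    c * ∫ t, v t ^ 2 ≤ (∫ t, v t ^ 2) + ∫ t, v t * ∫ u, H (t - u) * v u := by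
  have hN : Integrable (fun k => ‖𝓕 (fun t => (v t : ℂ)) k‖ ^ 2) :=
    integrable_norm_fourier_sq hv.ofReal hv2.ofReal
  have hpl : ∫ t, v t ^ 2 = ∫ k, ‖𝓕 (fun t => (v t : ℂ)) k‖ ^ 2 := by
    simpa [sq] using integral_mul_translate_eq hv hv2 0
  have hbd (k : ℝ) : ‖∫ s, H s * Real.cos (2 * Real.pi * k * s)‖ ≤ ∫ s, ‖H s‖ :=
    norm_integral_le_of_norm_le hL1.norm (.of_forall fun s => by
      rw [norm_mul]
      exact mul_le_of_le_one_right (norm_nonneg _) (Real.abs_cos_le_one _))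
  have hmeas : AEStronglyMeasurable (fun k : ℝ => ∫ s, H s * Real.cos (2 * Real.pi * k * s)) := by
    refine AEStronglyMeasurable.integral_prod_right'
      (f := fun p : ℝ × ℝ => H p.2 * Real.cos (2 * Real.pi * p.1 * p.2)) ?_
    exact hL1.aestronglyMeasurable.comp_snd.mul (by fun_prop)
  have hNH := hN.mul_bdd hmeas (.of_forall hbd)
  rw [integral_mul_integral_sub_mul_eq hL1 hv hv2, hpl, ← integral_const_mul,
    ← integral_add hN hNH]
  refine integral_mono (hN.const_mul c) (hN.add hNH) fun k => ?_
  have := mul_le_mul_of_nonneg_left (hc (2 * Real.pi * k))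
    (sq_nonneg ‖𝓕 (fun t => (v t : ℂ)) k‖)
  linarith

theorem memLp_comp_sub_left {H : ℝ → ℝ} (hL2 : MemLp H 2) (t : ℝ) :
    MemLp (fun u => H (t - u)) 2 :=
  hL2.comp_measurePreserving (Measure.measurePreserving_sub_left volume t)

theorem norm_setIntegral_sub_mul_le {H v : ℝ → ℝ} (hL2 : MemLp H 2) {S : Set ℝ}
    (hv : MemLp v 2 (volume.restrict S)) (t : ℝ) :
    ‖∫ u in S, H (t - u) * v u‖ ≤
      (eLpNorm H 2).toReal * (eLpNorm v 2 (volume.restrict S)).toReal := by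
  have ht := memLp_comp_sub_left hL2 t
  have htS := ht.restrict S
  have h1 : ∫ u in S, H (t - u) * v u = inner ℝ (hv.toLp v) (htS.toLp _) := by
    rw [L2.inner_def]
    apply integral_congr_ae
    filter_upwards [hv.coeFn_toLp, htS.coeFn_toLp] with u h1 h2
    rw [h1, h2]
    simp
  rw [h1, mul_comm]
  refine (norm_inner_le_norm _ _).trans ?_
  rw [Lp.norm_toLp, Lp.norm_toLp]
  gcongr
  · exact hL2.eLpNorm_ne_top
  · rw [← eLpNorm_comp_measurePreserving hL2.aestronglyMeasurable
      (Measure.measurePreserving_sub_left volume t)]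
    exact eLpNorm_mono_measure _ Measure.restrict_le_self

theorem aestronglyMeasurable_setIntegral_sub_mul {H v : ℝ → ℝ}
    (hH : AEStronglyMeasurable H) {S : Set ℝ}
    (hv : AEStronglyMeasurable v (volume.restrict S)) :
    AEStronglyMeasurable (fun t => ∫ u in S, H (t - u) * v u) (volume.restrict S) := by
  have := hv.convolution_integrand (ContinuousLinearMap.mul ℝ ℝ) hH
  refine (AEStronglyMeasurable.integral_prod_right'
    (f := fun p : ℝ × ℝ => H (p.1 - p.2) * v p.2) ?_).restrict
  simpa [mul_comm] using! this

theorem memLp_setIntegral_sub_mul {H v : ℝ → ℝ} (hL2 : MemLp H 2) {S : Set ℝ}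
    [IsFiniteMeasure (volume.restrict S)] (hv : MemLp v 2 (volume.restrict S)) :
    MemLp (fun t => ∫ u in S, H (t - u) * v u) 2 (volume.restrict S) :=
  .of_bound (aestronglyMeasurable_setIntegral_sub_mul hL2.1 hv.1) _
    (.of_forall fun t => norm_setIntegral_sub_mul_le hL2 hv t)

theorem integrable_sub_mul {H v : ℝ → ℝ} (hL2 : MemLp H 2) {S : Set ℝ}
    (hv : MemLp v 2 (volume.restrict S)) (t : ℝ) :
    Integrable (fun u => H (t - u) * v u) (volume.restrict S) :=
  ((memLp_comp_sub_left hL2 t).restrict S).integrable_mul hv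

/-- The truncated convolution operator `v ↦ ∫ u in S, H (· - u) * v u` on `L²(S)`, for `S` of
finite measure and `H ∈ L²(ℝ)`. -/
noncomputable def truncatedConvolution {H : ℝ → ℝ} (hL2 : MemLp H 2) (S : Set ℝ)
    [IsFiniteMeasure (volume.restrict S)] :
    Lp ℝ 2 (volume.restrict S) →L[ℝ] Lp ℝ 2 (volume.restrict S) :=
  LinearMap.mkContinuous
    { toFun := fun v => (memLp_setIntegral_sub_mul hL2 (Lp.memLp v)).toLp _
      map_add' := fun v w => by
        rw [← MemLp.toLp_add]
        refine MemLp.toLp_congr _ _ (.of_forall fun t => ?_)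
        simp only [Pi.add_apply]
        rw [← integral_add (integrable_sub_mul hL2 (Lp.memLp v) t)
          (integrable_sub_mul hL2 (Lp.memLp w) t)]
        apply integral_congr_ae
        filter_upwards [Lp.coeFn_add v w] with u hu
        rw [hu, Pi.add_apply, mul_add]
      map_smul' := fun a v => by
        rw [RingHom.id_apply, ← MemLp.toLp_const_smul]
        refine MemLp.toLp_congr _ _ (.of_forall fun t => ?_)
        simp only [Pi.smul_apply, smul_eq_mul]
        rw [← integral_const_mul]
        apply integral_congr_ae
        filter_upwards [Lp.coeFn_smul a v] with u hu
        rw [hu, Pi.smul_apply, smul_eq_mul, mul_left_comm] }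
    ((volume.restrict S).real univ ^ (2 : ℝ≥0∞).toReal⁻¹ * (eLpNorm H 2).toReal) (fun v => by
      rw [mul_assoc, Lp.norm_def v]
      refine Lp.norm_le_of_ae_bound (by positivity) ?_
      filter_upwards [(memLp_setIntegral_sub_mul hL2 (Lp.memLp v)).coeFn_toLp] with t ht
      rw [LinearMap.coe_mk, AddHom.coe_mk, ht]
      exact norm_setIntegral_sub_mul_le hL2 (Lp.memLp v) t)

theorem truncatedConvolution_ae_eq {H : ℝ → ℝ} (hL2 : MemLp H 2) (S : Set ℝ)
    [IsFiniteMeasure (volume.restrict S)] (v : Lp ℝ 2 (volume.restrict S)) :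
    truncatedConvolution hL2 S v =ᵐ[volume.restrict S] fun t => ∫ u in S, H (t - u) * v u :=
  (memLp_setIntegral_sub_mul hL2 (Lp.memLp v)).coeFn_toLp

theorem le_inner_add_truncatedConvolution {H : ℝ → ℝ} (hL1 : Integrable H) (hL2 : MemLp H 2)
    {c : ℝ} (hc : ∀ k : ℝ, c ≤ 1 + ∫ t : ℝ, H t * Real.cos (k * t))
    {S : Set ℝ} (hS : MeasurableSet S) [IsFiniteMeasure (volume.restrict S)]
    (v : Lp ℝ 2 (volume.restrict S)) :
    c * ‖v‖ * ‖v‖ ≤ inner ℝ (v + truncatedConvolution hL2 S v) v := by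
  have hv := Lp.memLp v
  have key := le_quadratic_form hL1 ((integrable_indicator_iff hS).2 (hv.integrable (by norm_num)))
    ((memLp_indicator_iff_restrict hS).2 hv) hc
  have h1 : ∫ t, S.indicator v t ^ 2 = ‖v‖ * ‖v‖ := by
    rw [← real_inner_self_eq_norm_mul_norm, L2.inner_def, ← integral_indicator hS]
    refine integral_congr_ae (.of_forall fun t => ?_)
    by_cases ht : t ∈ S <;> simp [ht, sq]
  have h2 (t : ℝ) : ∫ u, H (t - u) * S.indicator v u = ∫ u in S, H (t - u) * v u := by
    rw [← integral_indicator hS]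
    refine integral_congr_ae (.of_forall fun u => ?_)
    by_cases hu : u ∈ S <;> simp [hu]
  have h3 : ∫ t, S.indicator v t * ∫ u, H (t - u) * S.indicator v u =
      inner ℝ (truncatedConvolution hL2 S v) v := by
    have : ∀ t, S.indicator v t * ∫ u, H (t - u) * S.indicator v u =
        S.indicator (fun t => v t * ∫ u in S, H (t - u) * v u) t := fun t => by
      rw [h2]
      by_cases ht : t ∈ S <;> simp [ht]
    simp only [this]
    rw [integral_indicator hS, L2.inner_def]
    apply integral_congr_ae
    filter_upwards [truncatedConvolution_ae_eq hL2 S v] with t ht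
    rw [ht]
    simp
  rw [h1, h3] at key
  rw [inner_add_left, real_inner_self_eq_norm_mul_norm, mul_assoc]
  exact key

theorem bijective_of_coercive {V : Type*} [NormedAddCommGroup V] [InnerProductSpace ℝ V]
    [CompleteSpace V] (T : V →L[ℝ] V) {c : ℝ} (hc : 0 < c)
    (hT : ∀ v, c * ‖v‖ * ‖v‖ ≤ inner ℝ (T v) v) : Function.Bijective T := by
  have hco : IsCoercive ((innerSL ℝ).comp T) := ⟨c, hc, hT⟩
  have : ⇑T = hco.continuousLinearEquivOfBilin :=
    funext fun v => hco.unique_continuousLinearEquivOfBilin fun w => rfl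
  rw [this]
  exact hco.continuousLinearEquivOfBilin.bijective

/-- **Krein's truncated equation is uniquely solvable in `L²((0,x))`.**
For an even `H ∈ L¹(ℝ) ∩ L²(ℝ)` with `1 + Ĥ(k) > 0` for all `k`
(here `Ĥ(k) = ∫ H(t) cos(kt) dt`, which equals `∫ H(t) e^{ikt} dt` since `H` is
real and even), for every `x > 0` and every `h ∈ L²((0,x))` there is a unique
`Γ ∈ L²((0,x))` with `Γ(t) + ∫₀ˣ H(t-u) Γ(u) du = h(t)` for a.e. `t ∈ (0,x)`. -/
theorem krein_truncated_equation_uniquely_solvable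
    (H : ℝ → ℝ)
    (heven : ∀ t : ℝ, H (-t) = H t)
    (hL1 : Integrable H (volume : Measure ℝ))
    (hL2 : MemLp H 2 (volume : Measure ℝ))
    (hpos : ∀ k : ℝ, 0 < 1 + ∫ t : ℝ, H t * Real.cos (k * t))
    (x : ℝ) (hx : 0 < x)
    (h : ℝ → ℝ) (hh : MemLp h 2 (volume.restrict (Ioo 0 x))) :
    ∃ Γ : ℝ → ℝ, MemLp Γ 2 (volume.restrict (Ioo 0 x)) ∧
      (∀ᵐ t ∂(volume.restrict (Ioo 0 x)),
        Γ t + ∫ u in Ioo 0 x, H (t - u) * Γ u = h t) ∧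
      ∀ Γ' : ℝ → ℝ, MemLp Γ' 2 (volume.restrict (Ioo 0 x)) →
        (∀ᵐ t ∂(volume.restrict (Ioo 0 x)),
          Γ' t + ∫ u in Ioo 0 x, H (t - u) * Γ' u = h t) →
        Γ' =ᵐ[volume.restrict (Ioo 0 x)] Γ := by
  obtain ⟨c, hc0, hc⟩ := exists_pos_le_one_add_integral_cos hL1 hpos
  let T : Lp ℝ 2 (volume.restrict (Ioo 0 x)) →L[ℝ] Lp ℝ 2 (volume.restrict (Ioo 0 x)) :=
    .id ℝ _ + truncatedConvolution hL2 (Ioo 0 x)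
  have hbij := bijective_of_coercive T hc0
    (le_inner_add_truncatedConvolution hL1 hL2 hc measurableSet_Ioo)
  have hiff (v : Lp ℝ 2 (volume.restrict (Ioo 0 x))) :
      T v = hh.toLp h ↔
        ∀ᵐ t ∂(volume.restrict (Ioo 0 x)), v t + ∫ u in Ioo 0 x, H (t - u) * v u = h t := by
    rw [Lp.ext_iff]
    refine Filter.eventually_congr ?_
    filter_upwards [hh.coeFn_toLp, truncatedConvolution_ae_eq hL2 (Ioo 0 x) v,
      Lp.coeFn_add v (truncatedConvolution hL2 (Ioo 0 x) v)] with t h1 h2 h3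
    rw [h1, ← h2, ← Pi.add_apply, ← h3]
    rfl
  obtain ⟨v, hv⟩ := hbij.2 (hh.toLp h)
  refine ⟨v, Lp.memLp v, (hiff v).1 hv, fun Γ' hΓ' heq => ?_⟩
  have hw : T (hΓ'.toLp Γ') = hh.toLp h := by
    rw [hiff]
    filter_upwards [heq, hΓ'.coeFn_toLp] with t h1 h2
    rw [h2, ← h1]
    congr 1
    apply integral_congr_ae
    filter_upwards [hΓ'.coeFn_toLp] with u hu
    rw [hu]
  exact hΓ'.coeFn_toLp.symm.trans (Lp.ext_iff.1 (hbij.1 (hw.trans hv.symm)))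
end

section
/- Let H : ℝ → ℝ be an even function with H ∈ L¹(ℝ) ∩ L²(ℝ), and suppose 1 + Ĥ(k) > 0 for every k ∈ ℝ. Then there exists a constant c > 0 such that for every x > 0 and every real-valued v ∈ L²((0,x)): ∫₀ˣ ( v(t) + ∫₀ˣ H(t−u) v(u) du ) v(t) dt ≥ c ∫₀ˣ v(t)² dt; that is, the operator I + H_x is uniformly coercive on L²((0,x)). -/
open MeasureTheory Set
open scoped FourierTransform SchwartzMap InnerProductSpace

/-- The real part of the Fourier transform of a real function is its cosine transform. -/
theorem re_fourier_ofReal (H : ℝ → ℝ) (hL1 : Integrable H) (w : ℝ) :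
    (𝓕 (fun t => (H t : ℂ)) w).re = ∫ t : ℝ, H t * Real.cos (2 * Real.pi * w * t) := by
  rw [Real.fourier_eq]
  have hint := (Real.fourierIntegral_convergent_iff w).2 (hL1.ofReal (𝕜 := ℂ))
  rw [← RCLike.re_eq_complex_re, ← integral_re (by simpa using hint)]
  refine integral_congr_ae (Filter.Eventually.of_forall fun t => ?_)
  simp only [Circle.smul_def, Real.fourierChar_apply, RCLike.inner_apply, conj_trivial, smul_eq_mul]
  rw [RCLike.re_eq_complex_re, Complex.re_mul_ofReal, Complex.exp_ofReal_mul_I_re, mul_comm,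
    ← Real.cos_neg]
  congr 2
  ring

/-- A positive symbol `1 + Ĥ` with `H` integrable is bounded away from zero. -/
theorem exists_pos_le_one_add_cos_transform (H : ℝ → ℝ) (hL1 : Integrable H)
    (hpos : ∀ k : ℝ, 0 < 1 + ∫ t : ℝ, H t * Real.cos (k * t)) :
    ∃ c : ℝ, 0 < c ∧ ∀ w : ℝ, c ≤ 1 + ∫ t : ℝ, H t * Real.cos (2 * Real.pi * w * t) := by
  set g : ℝ → ℝ := fun w => 1 + (𝓕 (fun t => (H t : ℂ)) w).re with hg
  have hgc : Continuous g := by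
    have : Continuous (𝓕 (fun t => (H t : ℂ))) :=
      VectorFourier.fourierIntegral_continuous Real.continuous_fourierChar
        continuous_inner hL1.ofReal
    fun_prop
  have hlim : Filter.Tendsto g (Filter.cocompact ℝ) (nhds 1) := by
    have := (Complex.continuous_re.tendsto _).comp
      (Real.zero_at_infty_fourier (fun t => (H t : ℂ)))
    simpa [hg] using this.const_add 1
  have hgpos : ∀ w, 0 < g w := fun w => by
    simpa [hg, re_fourier_ofReal H hL1] using hpos (2 * Real.pi * w)
  obtain ⟨K, hK, hKg⟩ := Filter.mem_cocompact.1 (hlim.eventually (lt_mem_nhds one_half_lt_one))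
  obtain ⟨w₀, -, hw₀⟩ := (hK.insert 0).exists_isMinOn (insert_nonempty _ _) hgc.continuousOn
  refine ⟨min (1 / 2) (g w₀), lt_min one_half_pos (hgpos _), fun w => ?_⟩
  rw [← re_fourier_ofReal H hL1]
  by_cases hw : w ∈ K
  · exact (min_le_right _ _).trans (hw₀ (mem_insert_of_mem _ hw))
  · exact (min_le_left _ _).trans (hKg hw).le

/-- Plancherel for a Schwartz function and its translate. -/
theorem SchwartzMap.re_integral_inner_comp_sub (f : 𝓢(ℝ, ℂ)) (s : ℝ) :
    (∫ t, ⟪f t, f (t - s)⟫_ℂ).re = ∫ w, ‖𝓕 f w‖ ^ 2 * Real.cos (2 * Real.pi * w * s) := by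
  have hF : ∀ w, 𝓕 (f.compSubConstCLM ℂ s) w
      = Complex.exp (((-(2 * Real.pi * w * s) : ℝ) : ℂ) * Complex.I) * 𝓕 f w := by
    intro w
    rw [SchwartzMap.fourier_coe, SchwartzMap.fourier_coe, Real.fourier_eq, Real.fourier_eq,
      ← integral_add_right_eq_self _ s, ← integral_const_mul]
    refine integral_congr_ae (Filter.Eventually.of_forall fun t => ?_)
    simp only [Circle.smul_def, Real.fourierChar_apply, RCLike.inner_apply, conj_trivial,
      smul_eq_mul, SchwartzMap.compSubConstCLM_apply, add_sub_cancel_right]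
    rw [← mul_assoc, ← Complex.exp_add]
    congr 2
    push_cast
    ring
  have h := SchwartzMap.integral_inner_fourier_fourier f (f.compSubConstCLM ℂ s)
  simp only [SchwartzMap.compSubConstCLM_apply] at h
  have hint : Integrable fun w => ⟪𝓕 f w, 𝓕 (f.compSubConstCLM ℂ s) w⟫_ℂ := by
    have hmem : ∀ g : 𝓢(ℝ, ℂ), MemLp g 2 := fun g => g.memLp 2
    exact (memLp_one_iff_integrable.1 ((hmem (𝓕 f)).star.mul'
      (hmem (𝓕 (f.compSubConstCLM ℂ s))) (r := 1))).congr
      (Filter.Eventually.of_forall fun w => by simp [mul_comm])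
  rw [← h]
  rw [← RCLike.re_eq_complex_re, ← integral_re hint]
  refine integral_congr_ae (Filter.Eventually.of_forall fun w => ?_)
  simp only [hF, RCLike.inner_apply, RCLike.re_eq_complex_re]
  rw [mul_assoc, Complex.mul_conj, Complex.re_mul_ofReal, Complex.exp_ofReal_mul_I_re,
    Real.cos_neg, Complex.normSq_eq_norm_sq, mul_comm]

/-- Coercivity of the full-line convolution form on Schwartz functions. -/
theorem SchwartzMap.coercive_of_le_symbol (H : ℝ → ℝ) (hL1 : Integrable H) {c : ℝ}
    (hc : ∀ w : ℝ, c ≤ 1 + ∫ t : ℝ, H t * Real.cos (2 * Real.pi * w * t)) (f : 𝓢(ℝ, ℂ)) :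
    c * ∫ t, ‖f t‖ ^ 2 ≤
      (∫ t, ‖f t‖ ^ 2) + ∫ s, H s * (∫ t, ⟪f t, f (t - s)⟫_ℂ).re := by
  have hsq : Integrable fun w => ‖𝓕 f w‖ ^ 2 :=
    ((𝓕 f).memLp 2 (μ := volume)).integrable_norm_pow (by norm_num)
  have hprod : Integrable (fun p : ℝ × ℝ =>
      H p.1 * (‖𝓕 f p.2‖ ^ 2 * Real.cos (2 * Real.pi * p.2 * p.1))) (volume.prod volume) := by
    have := (hL1.mul_prod hsq).mul_bdd (c := 1)
      (g := fun p : ℝ × ℝ => Real.cos (2 * Real.pi * p.2 * p.1))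
      (by fun_prop : Continuous _).aestronglyMeasurable
      (Filter.Eventually.of_forall fun p => Real.abs_cos_le_one _)
    simpa only [mul_assoc] using this
  have hswap : ∫ s, H s * (∫ t, ⟪f t, f (t - s)⟫_ℂ).re
      = ∫ w, ‖𝓕 f w‖ ^ 2 * ∫ t, H t * Real.cos (2 * Real.pi * w * t) := by
    simp only [SchwartzMap.re_integral_inner_comp_sub, ← integral_const_mul]
    rw [integral_integral_swap hprod]
    simp only [mul_left_comm]
  have hint2 : Integrable fun w => ‖𝓕 f w‖ ^ 2 * ∫ t, H t * Real.cos (2 * Real.pi * w * t) := by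
    refine hprod.integral_prod_right.congr (Filter.Eventually.of_forall fun w => ?_)
    simp only [← integral_const_mul, mul_left_comm]
  rw [hswap, ← SchwartzMap.integral_norm_sq_fourier, ← integral_add hsq hint2,
    ← integral_const_mul]
  refine integral_mono (hsq.const_mul c) (hsq.add hint2) fun w => ?_
  have := mul_le_mul_of_nonneg_left (hc w) (sq_nonneg ‖𝓕 f w‖)
  linarith

/-- The translation form `f ↦ ∫ H(s) Re ⟪f, f(· - s)⟫ ds` is continuous on `L²`. -/
theorem continuous_integral_mul_re_inner_vadd (H : ℝ → ℝ) (hL1 : Integrable H) :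
    Continuous fun f : Lp ℂ 2 (volume : Measure ℝ) =>
      ∫ s, H s * (⟪f, DomAddAct.mk (-s) +ᵥ f⟫_ℂ).re := by
  have : Fact ((2 : ENNReal) ≠ ⊤) := ⟨ENNReal.ofNat_ne_top⟩
  have hcont : Continuous fun q : Lp ℂ 2 (volume : Measure ℝ) × ℝ =>
      (⟪q.1, DomAddAct.mk (-q.2) +ᵥ q.1⟫_ℂ).re := by
    have : Continuous fun q : Lp ℂ 2 (volume : Measure ℝ) × ℝ =>
        DomAddAct.mk (-q.2) +ᵥ q.1 :=
      (DomAddAct.continuous_mk.comp continuous_snd.neg).vadd continuous_fst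
    exact Complex.continuous_re.comp (continuous_fst.inner this)
  refine continuous_iff_continuousAt.2 fun f => ?_
  refine continuousAt_of_dominated (bound := fun s => ‖H s‖ * (‖f‖ + 1) ^ 2) ?_ ?_
    (hL1.norm.mul_const _) ?_
  · exact Filter.Eventually.of_forall fun g => hL1.aestronglyMeasurable.mul
      (hcont.comp (Continuous.prodMk_right g)).aestronglyMeasurable
  · have : ∀ᶠ g in nhds f, ‖g‖ < ‖f‖ + 1 :=
      (continuous_norm.tendsto f).eventually (gt_mem_nhds (lt_add_one _))
    filter_upwards [this] with g hg
    refine Filter.Eventually.of_forall fun s => ?_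
    rw [norm_mul]
    gcongr
    calc ‖(⟪g, DomAddAct.mk (-s) +ᵥ g⟫_ℂ).re‖ ≤ ‖⟪g, DomAddAct.mk (-s) +ᵥ g⟫_ℂ‖ :=
          Complex.abs_re_le_norm _
      _ ≤ ‖g‖ * ‖DomAddAct.mk (-s) +ᵥ g‖ := norm_inner_le_norm _ _
      _ = ‖g‖ ^ 2 := by rw [DomAddAct.norm_vadd_Lp, sq]
      _ ≤ (‖f‖ + 1) ^ 2 := by gcongr
  · exact Filter.Eventually.of_forall fun s =>
      (continuous_const.mul (hcont.comp (Continuous.prodMk_left s))).continuousAt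

/-- The inner product of the `L²` class of `f` with its translate, as an integral. -/
theorem inner_toLp_vadd_toLp {f : ℝ → ℂ} (hf : MemLp f 2) (s : ℝ) :
    ⟪hf.toLp f, DomAddAct.mk (-s) +ᵥ hf.toLp f⟫_ℂ = ∫ t, ⟪f t, f (t - s)⟫_ℂ := by
  rw [DomAddAct.mk_vadd_toLp, L2.inner_def]
  refine integral_congr_ae ?_
  filter_upwards [hf.coeFn_toLp, (hf.comp_measurePreserving
    (measurePreserving_vadd (-s) (volume : Measure ℝ))).coeFn_toLp] with t h1 h2
  rw [h1]
  erw [h2]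
  simp [neg_add_eq_sub]

/-- The squared `L²` norm of the class of `f`, as an integral. -/
theorem norm_toLp_sq {f : ℝ → ℂ} (hf : MemLp f 2) :
    ‖hf.toLp f‖ ^ 2 = ∫ t, ‖f t‖ ^ 2 := by
  rw [@norm_sq_eq_re_inner ℂ, L2.inner_def, ← integral_re (L2.integrable_inner _ _)]
  refine integral_congr_ae ?_
  filter_upwards [hf.coeFn_toLp] with t h1
  rw [h1, ← norm_sq_eq_re_inner]

/-- Coercivity of the full-line convolution form on `L²`. -/
theorem MeasureTheory.MemLp.coercive_of_le_symbol (H : ℝ → ℝ) (hL1 : Integrable H) {c : ℝ}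
    (hc : ∀ w : ℝ, c ≤ 1 + ∫ t : ℝ, H t * Real.cos (2 * Real.pi * w * t))
    {w : ℝ → ℝ} (hw : MemLp w 2) :
    c * ∫ t, w t ^ 2 ≤ (∫ t, w t ^ 2) + ∫ s, H s * ∫ t, w t * w (t - s) := by
  have hall : ∀ f : Lp ℂ 2 (volume : Measure ℝ),
      c * ‖f‖ ^ 2 ≤ ‖f‖ ^ 2 + ∫ s, H s * (⟪f, DomAddAct.mk (-s) +ᵥ f⟫_ℂ).re := by
    intro f
    refine (SchwartzMap.denseRange_toLpCLM (p := 2) (F := ℂ) ENNReal.ofNat_ne_top).induction_on f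
      (isClosed_le (by fun_prop) ((continuous_norm.pow 2).add
        (continuous_integral_mul_re_inner_vadd H hL1))) fun g => ?_
    change c * ‖(g.memLp 2 volume).toLp g‖ ^ 2 ≤ ‖(g.memLp 2 volume).toLp g‖ ^ 2 +
      ∫ s, H s * (⟪(g.memLp 2 volume).toLp g,
        DomAddAct.mk (-s) +ᵥ (g.memLp 2 volume).toLp g⟫_ℂ).re
    simp only [norm_toLp_sq, inner_toLp_vadd_toLp]
    exact g.coercive_of_le_symbol H hL1 hc
  have h := hall ((hw.ofReal (K := ℂ)).toLp _)
  simp only [norm_toLp_sq, inner_toLp_vadd_toLp] at h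
  have hre : ∀ s, (∫ t, ⟪((w t : ℝ) : ℂ), ((w (t - s) : ℝ) : ℂ)⟫_ℂ).re
      = ∫ t, w t * w (t - s) := by
    intro s
    have : (fun t => ⟪((w t : ℝ) : ℂ), ((w (t - s) : ℝ) : ℂ)⟫_ℂ)
        = fun t => ((w t * w (t - s) : ℝ) : ℂ) := by
      ext t
      simp [mul_comm]
    rw [this, integral_complex_ofReal, Complex.ofReal_re]
  simp only [RCLike.ofReal_eq_complex_ofReal, hre, Complex.norm_real] at h
  simpa using h

/-- The integrand of the convolution form is integrable on the product space. -/
theorem integrable_prod_mul_translate {H w : ℝ → ℝ} (hL1 : Integrable H) (hw : MemLp w 2) :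
    Integrable (fun p : ℝ × ℝ => H p.1 * (w p.2 * w (p.2 - p.1))) (volume.prod volume) := by
  have hm : AEStronglyMeasurable (fun p : ℝ × ℝ => H p.1 * (w p.2 * w (p.2 - p.1)))
      (volume.prod volume) := by
    have h3 : AEStronglyMeasurable (fun p : ℝ × ℝ => w (p.2 - p.1)) (volume.prod volume) :=
      hw.1.comp_quasiMeasurePreserving
        ((quasiMeasurePreserving_sub volume volume).comp
          Measure.measurePreserving_swap.quasiMeasurePreserving)
    exact hL1.1.comp_fst.mul (hw.1.comp_snd.mul h3)
  have htr : ∀ s, MemLp (fun t => w (t - s)) 2 := fun s =>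
    hw.comp_measurePreserving (measurePreserving_sub_right volume s)
  have hint : ∀ s, Integrable fun t => w t * w (t - s) := fun s =>
    memLp_one_iff_integrable.1 ((htr s).mul hw)
  refine (integrable_prod_iff hm).2
    ⟨Filter.Eventually.of_forall fun s => (hint s).const_mul (H s), ?_⟩
  refine (hL1.norm.mul_const (∫ t, w t ^ 2)).mono' hm.norm.integral_prod_right' ?_
  refine Filter.Eventually.of_forall fun s => ?_
  rw [Real.norm_of_nonneg (integral_nonneg fun _ => norm_nonneg _)]
  simp only [norm_mul (H s), integral_const_mul]
  refine mul_le_mul_of_nonneg_left ?_ (norm_nonneg _)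
  have hsq := hw.integrable_sq
  have hsq' := (htr s).integrable_sq
  have heq : ∫ t, w (t - s) ^ 2 = ∫ t, w t ^ 2 := integral_sub_right_eq_self (fun t => w t ^ 2) s
  calc ∫ t, ‖w t * w (t - s)‖ ≤ ∫ t, (w t ^ 2 + w (t - s) ^ 2) / 2 := by
        refine integral_mono (hint s).norm ((hsq.add hsq').div_const 2) fun t => ?_
        simp only [norm_mul, Real.norm_eq_abs]
        nlinarith [sq_nonneg (|w t| - |w (t - s)|), sq_abs (w t), sq_abs (w (t - s))]
    _ = ∫ t, w t ^ 2 := by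
        rw [integral_div, integral_add hsq hsq', heq]
        ring

/-- **Uniform coercivity of `I + H_x` on `L²((0,x))`.**
For an even `H ∈ L¹(ℝ) ∩ L²(ℝ)` with `1 + Ĥ(k) > 0` for all `k`
(here `Ĥ(k) = ∫ H(t) cos(kt) dt`, which equals `∫ H(t) e^{ikt} dt` since `H` is
real and even), there is `c > 0` such that for all `x > 0` and all real
`v ∈ L²((0,x))`:
`∫₀ˣ (v(t) + ∫₀ˣ H(t-u) v(u) du) v(t) dt ≥ c ∫₀ˣ v(t)² dt`. -/
theorem krein_operator_uniformly_coercive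
    (H : ℝ → ℝ)
    (heven : ∀ t : ℝ, H (-t) = H t)
    (hL1 : Integrable H (volume : Measure ℝ))
    (hL2 : MemLp H 2 (volume : Measure ℝ))
    (hpos : ∀ k : ℝ, 0 < 1 + ∫ t : ℝ, H t * Real.cos (k * t)) :
    ∃ c : ℝ, 0 < c ∧ ∀ x : ℝ, 0 < x → ∀ v : ℝ → ℝ,
      MemLp v 2 (volume.restrict (Ioo 0 x)) →
      c * ∫ t in Ioo 0 x, (v t) ^ 2 ≤
        ∫ t in Ioo 0 x, (v t + ∫ u in Ioo 0 x, H (t - u) * v u) * v t := by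
  obtain ⟨c, hc0, hc⟩ := exists_pos_le_one_add_cos_transform H hL1 hpos
  refine ⟨c, hc0, fun x _ v hv => ?_⟩
  set w : ℝ → ℝ := (Ioo 0 x).indicator v with hwdef
  have hw : MemLp w 2 := (memLp_indicator_iff_restrict measurableSet_Ioo).2 hv
  have hsq : ∫ t in Ioo 0 x, v t ^ 2 = ∫ t, w t ^ 2 := by
    rw [← integral_indicator measurableSet_Ioo]
    congr 1 with t
    by_cases ht : t ∈ Ioo 0 x <;> simp [hwdef, ht]
  have hinner : ∀ t, ∫ u in Ioo 0 x, H (t - u) * v u = ∫ s, H s * w (t - s) := by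
    intro t
    rw [← integral_indicator measurableSet_Ioo,
      ← integral_sub_left_eq_self (fun s => H s * w (t - s)) volume t]
    congr 1 with u
    by_cases hu : u ∈ Ioo 0 x <;> simp [hwdef, hu]
  have hprod := integrable_prod_mul_translate hL1 hw
  have hfull : ∫ t in Ioo 0 x, (v t + ∫ u in Ioo 0 x, H (t - u) * v u) * v t
      = ∫ t, (w t ^ 2 + ∫ s, H s * (w t * w (t - s))) := by
    rw [← integral_indicator measurableSet_Ioo]
    congr 1 with t
    simp only [hinner, mul_left_comm (H _), integral_const_mul]
    by_cases ht : t ∈ Ioo 0 x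
    · have : w t = v t := indicator_of_mem ht v
      rw [indicator_of_mem ht, this]
      ring
    · have : w t = 0 := indicator_of_notMem ht v
      rw [indicator_of_notMem ht, this]
      ring
  rw [hsq, hfull, integral_add hw.integrable_sq hprod.integral_prod_right,
    ← integral_integral_swap hprod]
  simpa only [integral_const_mul] using hw.coercive_of_le_symbol H hL1 hc
end

section
/- Let H : ℝ → ℝ be an even function with H ∈ L¹(ℝ) ∩ L²(ℝ), and suppose there is c > 0 with 1 + Ĥ(k) ≥ c for all k ∈ ℝ. Then for every x > 0 and every v ∈ L²((0,x)) one has c · ‖v‖_{L²((0,x))} ≤ ‖v + H_x v‖_{L²((0,x))}; i.e., the inverse operators (I + H_x)⁻¹ are bounded on L²((0,x)) by c⁻¹, uniformly in x > 0. -/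
open MeasureTheory Set

open Filter Topology FourierTransform Complex in
/-- An integrable function whose Fourier transform has nonnegative real part has nonnegative real
part at `0`, provided it is continuous there. -/
theorem re_apply_zero_nonneg_of_fourier_re_nonneg {f : ℝ → ℂ} (hf : Integrable f)
    (h0 : ContinuousAt f 0) (hpos : ∀ ξ, 0 ≤ (𝓕 f ξ).re) : 0 ≤ (f 0).re := by
  have key := Real.tendsto_integral_gaussian_smul' hf h0
  have hre := (Complex.continuous_re.tendsto _).comp key
  refine ge_of_tendsto hre ?_
  filter_upwards [Ioi_mem_atTop 0] with c (hc : 0 < c)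
  have J : Integrable (fun w : ℝ ↦ cexp (-(c⁻¹ : ℝ) * ‖w‖ ^ 2 + (0 : ℂ) * inner ℝ (0 : ℝ) w)) :=
    GaussianFourier.integrable_cexp_neg_mul_sq_norm_add (by simpa) _ _
  have K := VectorFourier.integral_fourierIntegral_smul_eq_flip (L := innerₗ ℝ)
      Real.continuous_fourierChar continuous_inner J hf
  have E : (∫ w : ℝ, ((Real.pi * c : ℂ) ^ (Module.finrank ℝ ℝ / 2 : ℂ) *
      cexp (-Real.pi ^ 2 * c * ‖(0 : ℝ) - w‖ ^ 2)) • f w) =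
      ∫ w : ℝ, ((Real.exp (-c⁻¹ * w ^ 2) : ℝ) : ℂ) * 𝓕 f w := by
    refine Eq.trans ?_ (K.trans ?_)
    · congr with w
      congr 1
      change _ = 𝓕 (fun w : ℝ ↦ cexp (-(c⁻¹ : ℝ) * ‖w‖ ^ 2 + (0 : ℂ) * inner ℝ (0 : ℝ) w)) w
      have := fourier_gaussian_innerProductSpace' (b := ((c⁻¹ : ℝ) : ℂ)) (by simpa) (0 : ℝ) w
      simp at this ⊢
      rw [this]
      ring_nf
    · congr with w
      rw [flip_innerₗ]
      change cexp (-(c⁻¹ : ℝ) * ‖w‖ ^ 2 + (0 : ℂ) * inner ℝ (0 : ℝ) w) * 𝓕 f w = _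
      simp [← ofReal_pow]
  simp only [Function.comp_apply]
  rw [E, ← RCLike.re_eq_complex_re, ← integral_re]
  · refine integral_nonneg fun w => ?_
    simp only [RCLike.re_eq_complex_re, re_ofReal_mul]
    exact mul_nonneg (Real.exp_nonneg _) (hpos w)
  · have hcont : Continuous (𝓕 f) := VectorFourier.fourierIntegral_continuous
      Real.continuous_fourierChar continuous_inner hf
    refine (Integrable.ofReal (integrable_exp_neg_mul_sq (inv_pos.2 hc))).mul_bdd
      hcont.aestronglyMeasurable (c := ∫ t, ‖f t‖) (ae_of_all _ fun w => ?_)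
    exact VectorFourier.norm_fourierIntegral_le_integral_norm _ _ _ _ _

/-- The correlation of two square-integrable functions is continuous. -/
theorem continuous_integral_mul_comp_sub {f g : ℝ → ℝ} (hf : MemLp f 2) (hg : MemLp g 2) :
    Continuous fun s => ∫ t, f t * g (t - s) := by
  have : Fact ((2 : ENNReal) ≠ ⊤) := ⟨by simp⟩
  have h : Continuous fun s : ℝ => inner ℝ (hf.toLp f) (DomAddAct.mk (-s) +ᵥ hg.toLp g) := by
    fun_prop
  refine h.congr fun s => ?_
  rw [DomAddAct.mk_vadd_toLp, L2.inner_def]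
  refine integral_congr_ae ?_
  filter_upwards [hf.coeFn_toLp, MemLp.coeFn_toLp (hg.comp_measurePreserving
    (measurePreserving_vadd (-s) volume))] with t h1 h2
  rw [h1]
  erw [h2]
  simp [mul_comm, sub_eq_neg_add]

/-- The convolution of two functions in `L¹ ∩ L²` is again in `L¹ ∩ L²`. -/
theorem integrable_and_memLp_two_convolution {f g : ℝ → ℝ} (hf1 : Integrable f) (hf2 : MemLp f 2)
    (hg1 : Integrable g) (hg2 : MemLp g 2) :
    Integrable (fun t => ∫ u, f (t - u) * g u) ∧ MemLp (fun t => ∫ u, f (t - u) * g u) 2 := by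
  have hint : Integrable (fun t => ∫ u, f (t - u) * g u) := by
    have := hg1.integrable_convolution (ContinuousLinearMap.mul ℝ ℝ) hf1
    refine this.congr (ae_of_all _ fun t => ?_)
    simp [convolution_def, mul_comm]
  refine ⟨hint, ?_⟩
  have hb : MemLp (fun t => ∫ u, f (t - u) * g u) ⊤ := by
    refine memLp_top_of_bound hint.1 (‖hf2.toLp f‖ * ‖hg2.toLp g‖) (ae_of_all _ fun t => ?_)
    have hm : MeasurePreserving (fun u : ℝ => t - u) :=
      Measure.measurePreserving_sub_left volume t
    have hft : MemLp (fun u => f (t - u)) 2 := hf2.comp_measurePreserving hm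
    have h1 : ∫ u, f (t - u) * g u = inner ℝ (hft.toLp _) (hg2.toLp g) := by
      rw [L2.inner_def]
      refine integral_congr_ae ?_
      filter_upwards [hft.coeFn_toLp, hg2.coeFn_toLp] with u h1 h2
      simp [h1, h2, mul_comm]
    have h2 : ‖hft.toLp _‖ = ‖hf2.toLp f‖ := by
      rw [Lp.norm_toLp, Lp.norm_toLp]
      congr 1
      exact eLpNorm_comp_measurePreserving hf2.1 hm
    rw [h1, ← h2]
    exact norm_inner_le_norm _ _
  rw [memLp_two_iff_integrable_sq hint.1]
  refine (hint.mul_of_top_left hb).congr (ae_of_all _ fun t => ?_)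
  simp [sq]

open FourierTransform ComplexConjugate in
/-- Reflecting a real-valued function conjugates its Fourier transform. -/
theorem fourier_ofReal_comp_neg (f : ℝ → ℝ) (ξ : ℝ) :
    𝓕 (fun t => (f (-t) : ℂ)) ξ = conj (𝓕 (fun t => (f t : ℂ)) ξ) := by
  rw [Real.fourier_real_eq_integral_exp_smul, Real.fourier_real_eq_integral_exp_smul,
    ← integral_conj, ← integral_neg_eq_self]
  congr with t
  simp only [smul_eq_mul, map_mul, ← Complex.exp_conj, Complex.conj_ofReal, Complex.conj_I]
  simp

open FourierTransform in
/-- The Fourier transform of a real even function is its cosine transform. -/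
theorem fourier_ofReal_even {f : ℝ → ℝ} (heven : ∀ t, f (-t) = f t) (hf : Integrable f) (ξ : ℝ) :
    𝓕 (fun t => (f t : ℂ)) ξ = ((∫ t, f t * Real.cos (2 * Real.pi * ξ * t) : ℝ) : ℂ) := by
  have hconj := fourier_ofReal_comp_neg f ξ
  simp only [heven] at hconj
  rw [← Complex.conj_eq_iff_re.1 hconj.symm]
  congr 1
  have hint : Integrable
      fun t : ℝ => Complex.exp (((-2 * Real.pi * t * ξ : ℝ) : ℂ) * Complex.I) • (f t : ℂ) := by
    refine hf.ofReal.bdd_mul (c := 1) (Continuous.aestronglyMeasurable (by fun_prop))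
      (ae_of_all _ fun t => (Complex.norm_exp_ofReal_mul_I _).le)
  rw [Real.fourier_real_eq_integral_exp_smul, ← RCLike.re_eq_complex_re, ← integral_re hint]
  congr with t
  rw [RCLike.re_eq_complex_re, smul_eq_mul, Complex.re_mul_ofReal, Complex.exp_ofReal_mul_I_re,
    mul_comm, ← Real.cos_neg]
  ring_nf

open FourierTransform Convolution in
/-- If `1 + Ĥ ≥ c`, then the quadratic form of `I + H ⋆ ·` is bounded below by `c`. -/
theorem const_mul_integral_sq_le_integral_mul_add_convolution {H w : ℝ → ℝ}
    (heven : ∀ t : ℝ, H (-t) = H t) (hL1 : Integrable H) (hL2 : MemLp H 2) {c : ℝ}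
    (hlb : ∀ k : ℝ, c ≤ 1 + ∫ t : ℝ, H t * Real.cos (k * t))
    (hw1 : Integrable w) (hw2 : MemLp w 2) :
    c * ∫ t, w t * w t ≤ ∫ t, w t * (w t + ∫ u, H (t - u) * w u) := by
  obtain ⟨hg1, hg2⟩ := integrable_and_memLp_two_convolution hL1 hL2 hw1 hw2
  set g : ℝ → ℝ := fun t => ∫ u, H (t - u) * w u with hg
  set F : ℝ → ℝ := fun t => (1 - c) * w t + g t with hF
  have hF1 : Integrable F := (hw1.const_mul _).add hg1
  have hF2 : MemLp F 2 := (hw2.const_mul _).add hg2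
  have hwm1 : Integrable fun t => w (-t) := hw1.comp_neg
  set φ : ℝ → ℂ := (fun t => (F t : ℂ)) ⋆[ContinuousLinearMap.mul ℂ ℂ] fun t => (w (-t) : ℂ)
    with hφ
  have hφ' : ∀ s, φ s = ((∫ t, F t * w (t - s) : ℝ) : ℂ) := by
    intro s
    rw [← integral_complex_ofReal]
    simp [hφ, convolution_def]
  have hφint : Integrable φ := hF1.ofReal.integrable_convolution _ hwm1.ofReal
  have hφcont : Continuous φ := by
    rw [funext hφ']
    exact Complex.continuous_ofReal.comp (continuous_integral_mul_comp_sub hF2 hw2)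
  have hgC : (fun t => (g t : ℂ)) =
      (fun t => (w t : ℂ)) ⋆[ContinuousLinearMap.mul ℂ ℂ] fun t => (H t : ℂ) := by
    ext t
    simp only [hg, convolution_def, ContinuousLinearMap.mul_apply', ← integral_complex_ofReal]
    push_cast
    simp only [mul_comm]
  have hFF : ∀ ξ, 𝓕 (fun t => (F t : ℂ)) ξ =
      ((1 - c : ℝ) + 𝓕 (fun t => (H t : ℂ)) ξ) * 𝓕 (fun t => (w t : ℂ)) ξ := by
    intro ξ
    have h1 : (fun t => (F t : ℂ)) =
        ((1 - c : ℝ) : ℂ) • (fun t => (w t : ℂ)) + fun t => (g t : ℂ) := by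
      ext t; simp [hF]
    have h2 : 𝓕 (fun t => (g t : ℂ)) ξ =
        𝓕 (fun t => (w t : ℂ)) ξ * 𝓕 (fun t => (H t : ℂ)) ξ := by
      rw [hgC]
      exact Real.fourier_mul_convolution_eq hw1.ofReal hL1.ofReal ξ
    have h3 : 𝓕 (fun t => (F t : ℂ)) = ((1 - c : ℝ) : ℂ) • 𝓕 (fun t => (w t : ℂ)) +
        𝓕 (fun t => (g t : ℂ)) := by
      rw [h1]
      refine (VectorFourier.fourierIntegral_add Real.continuous_fourierChar continuous_inner
        (hw1.ofReal.smul _) hg1.ofReal).trans ?_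
      rw [VectorFourier.fourierIntegral_const_smul]
      rfl
    rw [h3, Pi.add_apply, h2, Pi.smul_apply, smul_eq_mul]
    ring
  have hpos := re_apply_zero_nonneg_of_fourier_re_nonneg hφint hφcont.continuousAt fun ξ => by
    have h : 𝓕 φ ξ = 𝓕 (fun t => (F t : ℂ)) ξ * 𝓕 (fun t => (w (-t) : ℂ)) ξ :=
      Real.fourier_mul_convolution_eq hF1.ofReal hwm1.ofReal ξ
    rw [h, hFF, fourier_ofReal_even heven hL1,
      fourier_ofReal_comp_neg, mul_assoc,
      Complex.mul_conj, ← Complex.ofReal_add, ← Complex.ofReal_mul, Complex.ofReal_re]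
    exact mul_nonneg (by linarith [hlb (2 * Real.pi * ξ)]) (Complex.normSq_nonneg _)
  rw [hφ', Complex.ofReal_re] at hpos
  have hww : Integrable fun t => w t * w t := hw2.integrable_mul hw2
  have hwg : Integrable fun t => w t * g t := hw2.integrable_mul hg2
  have e1 : ∫ t, F t * w (t - 0) = (1 - c) * (∫ t, w t * w t) + ∫ t, w t * g t := by
    rw [← integral_const_mul, ← integral_add (hww.const_mul _) hwg]
    congr with t
    simp only [hF, sub_zero]; ring
  have e2 : ∫ t, w t * (w t + g t) = (∫ t, w t * w t) + ∫ t, w t * g t := by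
    rw [← integral_add hww hwg]
    congr with t
    ring
  rw [e1] at hpos
  change _ ≤ ∫ t, w t * (w t + g t)
  rw [e2]
  linarith

/-- **Uniform invertibility of `I + H_x` on `L²((0,x))`.**
Let `H : ℝ → ℝ` be even, `H ∈ L¹(ℝ) ∩ L²(ℝ)`, and suppose `1 + Ĥ(k) ≥ c > 0`
for all `k` (here `Ĥ(k) = ∫ H(t) cos(kt) dt`, which equals `∫ H(t) e^{ikt} dt`
since `H` is real and even). Then for every `x > 0` and every
`v ∈ L²((0,x))` one has `c‖v‖_{L²((0,x))} ≤ ‖v + H_x v‖_{L²((0,x))}`, i.e. the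
inverses `(I + H_x)⁻¹` are bounded by `c⁻¹` uniformly in `x > 0`. -/
theorem krein_operator_uniformly_bounded_inverse
    (H : ℝ → ℝ)
    (heven : ∀ t : ℝ, H (-t) = H t)
    (hL1 : Integrable H (volume : Measure ℝ))
    (hL2 : MemLp H 2 (volume : Measure ℝ))
    (c : ℝ) (hc : 0 < c)
    (hlb : ∀ k : ℝ, c ≤ 1 + ∫ t : ℝ, H t * Real.cos (k * t)) :
    ∀ x : ℝ, 0 < x → ∀ v : ℝ → ℝ,
      MemLp v 2 (volume.restrict (Ioo 0 x)) →
      ENNReal.ofReal c * eLpNorm v 2 (volume.restrict (Ioo 0 x)) ≤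
        eLpNorm (fun t => v t + ∫ u in Ioo 0 x, H (t - u) * v u) 2
          (volume.restrict (Ioo 0 x)) := by
  intro x hx v hv
  set w : ℝ → ℝ := (Ioo 0 x).indicator v with hw
  have hw2 : MemLp w 2 := (memLp_indicator_iff_restrict measurableSet_Ioo).2 hv
  have hw1 : Integrable w := (integrable_indicator_iff measurableSet_Ioo).2
    (hv.integrable one_le_two)
  have hconv : ∀ t, ∫ u in Ioo 0 x, H (t - u) * v u = ∫ u, H (t - u) * w u := by
    intro t
    rw [← integral_indicator measurableSet_Ioo]
    congr with u
    simp [hw, indicator_apply]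
  have hquad := const_mul_integral_sq_le_integral_mul_add_convolution heven hL1 hL2 hlb hw1 hw2
  simp only [← hconv] at hquad
  have hF : MemLp (fun t => v t + ∫ u in Ioo 0 x, H (t - u) * v u) 2
      (volume.restrict (Ioo 0 x)) := by
    simp only [hconv]
    exact hv.add ((integrable_and_memLp_two_convolution hL1 hL2 hw1 hw2).2.restrict _)
  set F : ℝ → ℝ := fun t => v t + ∫ u in Ioo 0 x, H (t - u) * v u with hFdef
  have hinner : ∀ {f : ℝ → ℝ} (hf : MemLp f 2 (volume.restrict (Ioo 0 x))),
      inner ℝ (hv.toLp v) (hf.toLp f) = ∫ t in Ioo 0 x, v t * f t := by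
    intro f hf
    rw [L2.inner_def]
    refine integral_congr_ae ?_
    filter_upwards [hv.coeFn_toLp, hf.coeFn_toLp] with t h1 h2
    simp [h1, h2, mul_comm]
  have e1 : ∫ t, w t * w t = inner ℝ (hv.toLp v) (hv.toLp v) := by
    rw [hinner hv, ← integral_indicator measurableSet_Ioo]
    congr with t
    by_cases ht : t ∈ Ioo 0 x <;> simp [hw, ht]
  have e2 : ∫ t, w t * (w t + ∫ u in Ioo 0 x, H (t - u) * v u) =
      inner ℝ (hv.toLp v) (hF.toLp F) := by
    rw [hinner hF, ← integral_indicator measurableSet_Ioo]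
    congr with t
    by_cases ht : t ∈ Ioo 0 x <;> simp [hw, hFdef, ht]
  rw [e1, e2, real_inner_self_eq_norm_sq] at hquad
  have hle : c * ‖hv.toLp v‖ ≤ ‖hF.toLp F‖ := by
    have hcs := hquad.trans (real_inner_le_norm _ _)
    rcases (norm_nonneg (hv.toLp v)).eq_or_lt with h0 | h0
    · rw [← h0, mul_zero]; exact norm_nonneg _
    · exact le_of_mul_le_mul_left (by nlinarith) h0
  rw [Lp.norm_toLp, Lp.norm_toLp, ← ENNReal.toReal_ofReal hc.le, ← ENNReal.toReal_mul] at hle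
  exact (ENNReal.toReal_le_toReal (ENNReal.mul_ne_top ENNReal.ofReal_ne_top hv.eLpNorm_ne_top)
    hF.eLpNorm_ne_top).1 hle
end

section
/- Let H : ℝ → ℝ be an even function with H ∈ L¹(ℝ) ∩ L²(ℝ) and 1 + Ĥ(k) > 0 for all k ∈ ℝ. If Γ₁, Γ₂ ∈ L²((0,∞)) both satisfy Γ(t) + ∫₀^∞ H(t−u) Γ(u) du = H(t) for almost every t > 0, then Γ₁ = Γ₂ almost everywhere on (0,∞); i.e., the limiting Krein equation (1.25) has at most one L² solution. -/
open MeasureTheory Set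

open FourierTransform SchwartzMap ComplexInnerProductSpace

/-- The Fourier transform turns a translation of a Schwartz function into a modulation. -/
theorem SchwartzMap.fourier_compSubConstCLM (f : 𝓢(ℝ, ℂ)) (s k : ℝ) :
    𝓕 (f.compSubConstCLM ℂ s) k = (Real.fourierChar (-(s * k)) : ℂ) * 𝓕 f k := by
  rw [SchwartzMap.fourier_coe, SchwartzMap.fourier_coe, Real.fourier_real_eq,
    Real.fourier_real_eq, ← integral_const_mul]
  rw [← integral_sub_right_eq_self
    (fun t ↦ (Real.fourierChar (-(s * k)) : ℂ) * (Real.fourierChar (-(t * k)) • f t)) s]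
  refine integral_congr_ae (.of_forall fun t ↦ ?_)
  simp only [SchwartzMap.compSubConstCLM_apply, Circle.smul_def, smul_eq_mul, ← mul_assoc,
    ← Circle.coe_mul, ← AddChar.map_add_eq_mul]
  congr 4
  ring

/-- The `L²` Fourier transform turns a translation into a modulation. -/
theorem MeasureTheory.Lp.fourier_comp_sub_const (f : Lp (α := ℝ) ℂ 2) (s : ℝ) :
    (𝓕 (Lp.compMeasurePreserving (· - s) (measurePreserving_sub_right volume s) f) :
      Lp (α := ℝ) ℂ 2) =ᵐ[volume]
      fun k ↦ (Real.fourierChar (-(s * k)) : ℂ) * (𝓕 f : Lp (α := ℝ) ℂ 2) k := by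
  have hc : MemLp (fun k : ℝ ↦ (Real.fourierChar (-(s * k)) : ℂ)) ⊤ volume := by
    refine memLp_top_of_bound (C := 1) (Continuous.aestronglyMeasurable ?_)
      (.of_forall fun k ↦ (Circle.norm_coe _).le)
    have := Real.continuous_fourierChar
    fun_prop
  let M := (ContinuousLinearMap.mul ℂ ℂ).holderL volume ⊤ 2 2 hc.toLp
  have hM (f : Lp (α := ℝ) ℂ 2) :
      M f =ᵐ[volume] fun k ↦ (Real.fourierChar (-(s * k)) : ℂ) * f k := by
    filter_upwards [(ContinuousLinearMap.mul ℂ ℂ).coeFn_holder (r := 2) hc.toLp f,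
      hc.coeFn_toLp] with k h h'
    simp [M, h, h']
  suffices h : 𝓕 (Lp.compMeasurePreserving (· - s) (measurePreserving_sub_right volume s) f) =
      M (𝓕 f) by
    rw [h]; exact hM _
  refine DenseRange.induction_on
    (p := fun f : Lp (α := ℝ) ℂ 2 ↦
      𝓕 (Lp.compMeasurePreserving (· - s) (measurePreserving_sub_right volume s) f) = M (𝓕 f))
    (SchwartzMap.denseRange_toLpCLM (p := 2) ENNReal.ofNat_ne_top) f
    (isClosed_eq ?_ ?_) fun f ↦ ?_
  · exact (Lp.fourierTransformₗᵢ ℝ ℂ).continuous.comp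
      (Lp.isometry_compMeasurePreserving _).continuous
  · exact M.continuous.comp (Lp.fourierTransformₗᵢ ℝ ℂ).continuous
  · have h : Lp.compMeasurePreserving (· - s) (measurePreserving_sub_right volume s)
        (f.toLp 2) = (f.compSubConstCLM ℂ s).toLp 2 := rfl
    rw [SchwartzMap.toLpCLM_apply, h, SchwartzMap.toLp_fourier_eq, SchwartzMap.toLp_fourier_eq]
    ext1
    filter_upwards [hM ((𝓕 f).toLp 2), (𝓕 f).coeFn_toLp 2 volume,
      (𝓕 (f.compSubConstCLM ℂ s)).coeFn_toLp 2 volume] with k h₁ h₂ h₃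
    rw [h₁, h₂, h₃, SchwartzMap.fourier_compSubConstCLM]

/-- The autocorrelation of a real square-integrable function is the cosine transform of an integrable
nonnegative spectral density, which vanishes only if the function does. -/
theorem MeasureTheory.MemLp.exists_autocorrelation_eq_integral_cos {g : ℝ → ℝ}
    (hg : MemLp g 2 volume) :
    ∃ w : ℝ → ℝ, Integrable w volume ∧ 0 ≤ w ∧ (w =ᵐ[volume] 0 → g =ᵐ[volume] 0) ∧
      ∀ s, ∫ t, g t * g (t - s) = ∫ k, w k * Real.cos (2 * Real.pi * k * s) := by
  have hG : MemLp (fun t ↦ (g t : ℂ)) 2 volume := hg.ofReal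
  set G : Lp (α := ℝ) ℂ 2 := hG.toLp
  have hGg : G =ᵐ[volume] fun t ↦ (g t : ℂ) := hG.coeFn_toLp
  set F : Lp (α := ℝ) ℂ 2 volume := 𝓕 G with hF
  have hw : Integrable (fun k ↦ ‖F k‖ ^ 2) volume := (Lp.memLp F).integrable_norm_pow (by norm_num)
  refine ⟨fun k ↦ ‖F k‖ ^ 2, hw, fun k ↦ by positivity, fun h ↦ ?_, fun s ↦ ?_⟩
  · have hF0 : F = 0 := by
      ext1
      filter_upwards [h, Lp.coeFn_zero ℂ 2 (volume : Measure ℝ)] with k hk hk'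
      simpa [hk'] using hk
    have hG0 : G = 0 := by
      rw [← norm_eq_zero, ← Lp.norm_fourier_eq, ← hF, hF0, norm_zero]
    rw [hG0] at hGg
    filter_upwards [hGg, Lp.coeFn_zero ℂ 2 (volume : Measure ℝ)] with t ht ht'
    rw [ht'] at ht
    simpa using ht.symm
  · have h := congrArg Complex.re (Lp.inner_fourier_eq G
      (Lp.compMeasurePreserving (· - s) (measurePreserving_sub_right volume s) G))
    rw [L2.inner_def, L2.inner_def] at h
    have e₁ : ∫ t, ⟪G t, Lp.compMeasurePreserving (· - s)
        (measurePreserving_sub_right volume s) G t⟫ = ((∫ t, g t * g (t - s) : ℝ) : ℂ) := by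
      rw [← integral_complex_ofReal]
      refine integral_congr_ae ?_
      filter_upwards [hGg, Lp.coeFn_compMeasurePreserving G
        (measurePreserving_sub_right volume s),
        (measurePreserving_sub_right volume s).quasiMeasurePreserving.ae_eq_comp hGg]
        with t h₁ h₂ h₃
      rw [h₁, h₂, h₃]
      simp [mul_comm]
    rw [e₁, Complex.ofReal_re] at h
    rw [← h]
    have e₂ := integral_re (L2.integrable_inner (𝕜 := ℂ) F (𝓕 (Lp.compMeasurePreserving (· - s)
        (measurePreserving_sub_right volume s) G) : Lp (α := ℝ) ℂ 2 volume))
    refine Eq.trans e₂.symm (integral_congr_ae ?_)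
    filter_upwards [Lp.fourier_comp_sub_const G s] with k hk
    rw [hk, ← hF]
    have : (Real.fourierChar (-(s * k)) : ℂ).re = Real.cos (2 * Real.pi * k * s) := by
      rw [Real.fourierChar_apply, Complex.exp_ofReal_mul_I_re, ← Real.cos_neg]
      congr 1
      ring
    rw [← this, RCLike.inner_apply, mul_assoc, Complex.mul_conj, Complex.normSq_eq_norm_sq]
    exact (Complex.re_mul_ofReal _ _).trans (mul_comm _ _)

theorem integrable_prod_mul_mul_comp_sub {H g : ℝ → ℝ} (hH : Integrable H volume)
    (hg : MemLp g 2 volume) :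
    Integrable (fun p : ℝ × ℝ ↦ H p.2 * (g p.1 * g (p.1 - p.2))) (volume.prod volume) := by
  have hmp : MeasurePreserving (fun p : ℝ × ℝ ↦ (p.1 - p.2, p.2))
      (volume.prod volume) (volume.prod volume) := measurePreserving_sub_prod volume volume
  have h₁ : Integrable (fun p : ℝ × ℝ ↦ g p.1 ^ 2 * H p.2) (volume.prod volume) :=
    hg.integrable_sq.mul_prod hH
  have h₂ : Integrable (fun p : ℝ × ℝ ↦ g (p.1 - p.2) ^ 2 * H p.2) (volume.prod volume) :=
    hmp.integrable_comp_of_integrable h₁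
  refine (h₁.norm.add h₂.norm).mono' ?_ (.of_forall fun p ↦ ?_)
  · have hgm := hg.aestronglyMeasurable
    exact hH.aestronglyMeasurable.comp_snd.mul (hgm.comp_fst.mul
      (hgm.comp_fst.comp_measurePreserving hmp))
  · simp only [Pi.add_apply, norm_mul, norm_pow]
    nlinarith [norm_nonneg (H p.2), sq_nonneg (‖g p.1‖ - ‖g (p.1 - p.2)‖),
      mul_nonneg (norm_nonneg (H p.2)) (sq_nonneg (‖g p.1‖ - ‖g (p.1 - p.2)‖)),
      mul_nonneg (norm_nonneg (H p.2)) (sq_nonneg ‖g p.1‖),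
      mul_nonneg (norm_nonneg (H p.2)) (sq_nonneg ‖g (p.1 - p.2)‖)]

/-- If the symbol `1 + Ĥ` is positive, the quadratic form of `1 + H ∗ ·` on `L²` is definite: a
function `g` with `g * (g + H ∗ g) = 0` vanishes. -/
theorem ae_eq_zero_of_mul_add_convolution_ae_eq_zero {H g : ℝ → ℝ}
    (hH : Integrable H volume) (hpos : ∀ k : ℝ, 0 < 1 + ∫ t : ℝ, H t * Real.cos (k * t))
    (hg : MemLp g 2 volume) (h : ∀ᵐ t, g t * (g t + ∫ u, H (t - u) * g u) = 0) :
    g =ᵐ[volume] 0 := by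
  obtain ⟨w, hw, hw0, hwg, hcorr⟩ := hg.exists_autocorrelation_eq_integral_cos
  have hint := integrable_prod_mul_mul_comp_sub hH hg
  have hconv (t : ℝ) : g t * ∫ u, H (t - u) * g u = ∫ s, H s * (g t * g (t - s)) := by
    rw [← integral_const_mul, ← integral_sub_left_eq_self _ _ t]
    refine integral_congr_ae (.of_forall fun s ↦ ?_)
    simp only [sub_sub_cancel]
    ring
  have hwH : Integrable (fun p : ℝ × ℝ ↦ w p.1 * (H p.2 * Real.cos (2 * Real.pi * p.1 * p.2)))
      (volume.prod volume) := by
    have := (hw.mul_prod hH).mul_bdd (c := 1)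
      (g := fun p : ℝ × ℝ ↦ Real.cos (2 * Real.pi * p.1 * p.2))
      (Continuous.aestronglyMeasurable (by fun_prop))
      (.of_forall fun p ↦ Real.abs_cos_le_one _)
    simpa only [mul_assoc] using this
  have hform : ∫ t, g t * ∫ u, H (t - u) * g u =
      ∫ k, w k * ∫ s, H s * Real.cos (2 * Real.pi * k * s) := by
    simp_rw [hconv, ← integral_const_mul]
    rw [integral_integral_swap (f := fun t s ↦ H s * (g t * g (t - s))) hint,
      integral_integral_swap
        (f := fun k s ↦ w k * (H s * Real.cos (2 * Real.pi * k * s))) hwH]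
    refine integral_congr_ae (.of_forall fun s ↦ ?_)
    simp only [integral_const_mul, hcorr]
    rw [← integral_const_mul]
    refine integral_congr_ae (.of_forall fun k ↦ ?_)
    ring
  have hsq : ∫ t, g t * g t = ∫ k, w k := by simpa using hcorr 0
  have hgg : Integrable (fun t ↦ g t * g t) volume := by simpa [sq] using hg.integrable_sq
  have hwi : Integrable (fun k ↦ w k * ∫ s, H s * Real.cos (2 * Real.pi * k * s)) volume := by
    simpa only [integral_const_mul] using hwH.integral_prod_left
  have hgi : Integrable (fun t ↦ g t * ∫ u, H (t - u) * g u) volume := by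
    simpa only [hconv] using hint.integral_prod_left
  have hzero : ∫ k, w k * (1 + ∫ s, H s * Real.cos (2 * Real.pi * k * s)) = 0 := by
    simp_rw [mul_add, mul_one]
    rw [integral_add hw hwi, ← hform, ← hsq, ← integral_add hgg hgi]
    simp_rw [← mul_add]
    exact integral_eq_zero_of_ae h
  rw [integral_eq_zero_iff_of_nonneg (fun k ↦ mul_nonneg (hw0 k) (hpos _).le)
    ((hw.add hwi).congr (.of_forall fun k ↦ (mul_one_add _ _).symm))] at hzero
  refine hwg ?_
  filter_upwards [hzero] with k hk
  exact (mul_eq_zero.mp hk).resolve_right (hpos _).ne'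

/-- **Uniqueness for Krein's limiting equation (1.25) in `L²((0,∞))`.**
Let `H : ℝ → ℝ` be even, `H ∈ L¹(ℝ) ∩ L²(ℝ)`, with `1 + Ĥ(k) > 0` for all `k`
(here `Ĥ(k) = ∫ H(t) cos(kt) dt`, which equals `∫ H(t) e^{ikt} dt` since `H`
is real and even). If `Γ₁, Γ₂ ∈ L²((0,∞))` both satisfy
`Γ(t) + ∫₀^∞ H(t-u) Γ(u) du = H(t)` for a.e. `t > 0`, then `Γ₁ = Γ₂` a.e.
on `(0,∞)`. -/
theorem krein_limiting_equation_unique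
    (H : ℝ → ℝ)
    (heven : ∀ t : ℝ, H (-t) = H t)
    (hL1 : Integrable H (volume : Measure ℝ))
    (hL2 : MemLp H 2 (volume : Measure ℝ))
    (hpos : ∀ k : ℝ, 0 < 1 + ∫ t : ℝ, H t * Real.cos (k * t))
    (Γ₁ Γ₂ : ℝ → ℝ)
    (h₁ : MemLp Γ₁ 2 (volume.restrict (Ioi 0)))
    (h₂ : MemLp Γ₂ 2 (volume.restrict (Ioi 0)))
    (heq₁ : ∀ᵐ t ∂(volume.restrict (Ioi 0)),
      Γ₁ t + ∫ u in Ioi (0:ℝ), H (t - u) * Γ₁ u = H t)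
    (heq₂ : ∀ᵐ t ∂(volume.restrict (Ioi 0)),
      Γ₂ t + ∫ u in Ioi (0:ℝ), H (t - u) * Γ₂ u = H t) :
    Γ₁ =ᵐ[volume.restrict (Ioi 0)] Γ₂ := by
  have hHt (t : ℝ) : MemLp (fun u ↦ H (t - u)) 2 (volume.restrict (Ioi 0)) :=
    (hL2.comp_measurePreserving (volume.measurePreserving_sub_left t)).restrict _
  have hg : MemLp ((Ioi (0 : ℝ)).indicator (Γ₁ - Γ₂)) 2 volume :=
    (memLp_indicator_iff_restrict measurableSet_Ioi).mpr (h₁.sub h₂)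
  have key := ae_eq_zero_of_mul_add_convolution_ae_eq_zero hL1 hpos hg ?_
  · have := ae_restrict_of_ae (s := Ioi (0 : ℝ)) key
    filter_upwards [this, ae_restrict_mem measurableSet_Ioi] with t ht htm
    simpa [indicator_of_mem htm, sub_eq_zero] using ht
  · rw [ae_restrict_iff' measurableSet_Ioi] at heq₁ heq₂
    filter_upwards [heq₁, heq₂] with t e₁ e₂
    by_cases ht : t ∈ Ioi (0 : ℝ)
    · have hsub : ∫ u, H (t - u) * (Ioi (0 : ℝ)).indicator (Γ₁ - Γ₂) u =
          (∫ u in Ioi (0 : ℝ), H (t - u) * Γ₁ u) - ∫ u in Ioi (0 : ℝ), H (t - u) * Γ₂ u := by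
        refine Eq.trans ?_ (integral_sub ((hHt t).integrable_mul h₁) ((hHt t).integrable_mul h₂))
        rw [← integral_indicator measurableSet_Ioi]
        refine integral_congr_ae (.of_forall fun u ↦ ?_)
        by_cases hu : u ∈ Ioi (0 : ℝ) <;> simp [hu, mul_sub]
      rw [hsub, indicator_of_mem ht, Pi.sub_apply]
      refine mul_eq_zero_of_right _ ?_
      linarith [e₁ ht, e₂ ht]
    · simp [indicator_of_notMem ht]
end

section
/- Let g : (0,∞) → ℝ be measurable with g ∈ L¹((0,∞)) and t ↦ t·g(t) ∈ L¹((0,∞)). Define w : ℝ → ℝ by w(k) := (1/k) ∫₀^∞ g(t) sin(kt) dt for k ≠ 0 and w(0) := ∫₀^∞ t g(t) dt. Then w is continuous on ℝ and w ∈ L²(ℝ). -/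
open MeasureTheory Set

/-- The integrand of the sine transform divided by `k`, written with `Real.sinc`. -/
theorem sine_transform_over_k_eq_integral_sinc (g : ℝ → ℝ) (k : ℝ) :
    (if k = 0 then ∫ t in Ioi (0:ℝ), t * g t
      else (1 / k) * ∫ t in Ioi (0:ℝ), g t * Real.sin (k * t)) =
    ∫ t in Ioi (0:ℝ), t * g t * Real.sinc (k * t) := by
  split_ifs with hk
  · simp [hk]
  · rw [← integral_const_mul]
    refine setIntegral_congr_fun measurableSet_Ioi fun t ht => ?_
    have ht0 : t ≠ 0 := ne_of_gt ht
    simp only [Real.sinc_of_ne_zero (mul_ne_zero hk ht0)]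
    field_simp

theorem continuous_integral_mul_sinc {f : ℝ → ℝ} {s : Set ℝ} (hf : IntegrableOn f s) :
    Continuous fun k : ℝ => ∫ t in s, f t * Real.sinc (k * t) := by
  refine continuous_of_dominated (bound := fun t => ‖f t‖) (fun k => ?_) (fun k => ?_)
    hf.norm ?_
  · exact hf.aestronglyMeasurable.mul
      (Real.continuous_sinc.comp (by fun_prop)).aestronglyMeasurable
  · refine Filter.Eventually.of_forall fun t => ?_
    rw [norm_mul]
    exact mul_le_of_le_one_right (norm_nonneg _) (Real.abs_sinc_le_one _)
  · refine Filter.Eventually.of_forall fun t => ?_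
    exact continuous_const.mul (Real.continuous_sinc.comp (by fun_prop))

theorem norm_integral_mul_le_of_abs_le_one {f φ : ℝ → ℝ} {s : Set ℝ} (hf : IntegrableOn f s)
    (hφ : ∀ t, |φ t| ≤ 1) : ‖∫ t in s, f t * φ t‖ ≤ ∫ t in s, ‖f t‖ := by
  refine norm_integral_le_of_norm_le hf.norm (Filter.Eventually.of_forall fun t => ?_)
  rw [norm_mul]
  exact mul_le_of_le_one_right (norm_nonneg _) (hφ t)

/-- A measurable function which is bounded and `O(1 / |k|)` is square integrable. -/
theorem memLp_two_of_bounded_of_mul_bounded {w : ℝ → ℝ} {A B : ℝ}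
    (hw : AEStronglyMeasurable w) (hB : ∀ k, |w k| ≤ B) (hA : ∀ k, |k * w k| ≤ A) :
    MemLp w 2 := by
  rw [memLp_two_iff_integrable_sq hw]
  refine (integrable_inv_one_add_sq.const_mul (A ^ 2 + B ^ 2)).mono' (hw.pow 2)
    (Filter.Eventually.of_forall fun k => ?_)
  have h1 := sq_le_sq' (neg_le_of_abs_le (hB k)) (le_of_abs_le (hB k))
  have h2 := sq_le_sq' (neg_le_of_abs_le (hA k)) (le_of_abs_le (hA k))
  rw [Real.norm_of_nonneg (sq_nonneg _), ← div_eq_mul_inv, le_div_iff₀ (by positivity)]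
  linarith [mul_pow k (w k) 2]

/-- **The function `w(k) = (1/k)∫₀^∞ g(t) sin(kt) dt` is continuous and in
`L²(ℝ)` (formula (2.51)).** Let `g : (0,∞) → ℝ` be measurable with
`g ∈ L¹((0,∞))` and `t ↦ t g(t) ∈ L¹((0,∞))`. Define `w(k)` to be
`(1/k)∫₀^∞ g(t) sin(kt) dt` for `k ≠ 0` and `w(0) = ∫₀^∞ t g(t) dt`. Then
`w` is continuous on `ℝ` and `w ∈ L²(ℝ)`. -/
theorem sine_transform_over_k_continuous_and_L2
    (g : ℝ → ℝ) (hmeas : Measurable g)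
    (hg1 : IntegrableOn g (Ioi 0))
    (hg2 : IntegrableOn (fun t => t * g t) (Ioi 0)) :
    Continuous (fun k : ℝ =>
      if k = 0 then ∫ t in Ioi (0:ℝ), t * g t
      else (1 / k) * ∫ t in Ioi (0:ℝ), g t * Real.sin (k * t)) ∧
    MemLp (fun k : ℝ =>
      if k = 0 then ∫ t in Ioi (0:ℝ), t * g t
      else (1 / k) * ∫ t in Ioi (0:ℝ), g t * Real.sin (k * t)) 2
      (volume : Measure ℝ) := by
  have hcont : Continuous (fun k : ℝ =>
      if k = 0 then ∫ t in Ioi (0:ℝ), t * g t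
      else (1 / k) * ∫ t in Ioi (0:ℝ), g t * Real.sin (k * t)) := by
    simpa only [sine_transform_over_k_eq_integral_sinc] using continuous_integral_mul_sinc hg2
  refine ⟨hcont, memLp_two_of_bounded_of_mul_bounded (A := ∫ t in Ioi (0:ℝ), ‖g t‖)
    (B := ∫ t in Ioi (0:ℝ), ‖t * g t‖) hcont.aestronglyMeasurable (fun k => ?_) fun k => ?_⟩
  · rw [sine_transform_over_k_eq_integral_sinc]
    exact norm_integral_mul_le_of_abs_le_one hg2 fun t => Real.abs_sinc_le_one _
  · split_ifs with hk
    · simpa [hk] using integral_nonneg fun t => abs_nonneg (g t)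
    · rw [← mul_assoc, mul_one_div_cancel hk, one_mul]
      exact norm_integral_mul_le_of_abs_le_one hg1 fun t => Real.abs_sin_le_one _
end
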